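/- arXiv:1411.5635 — 8 statements merged into one kernel-verified Lean document; each statement's English description precedes it below -/
import Mathlib

section
/- Let ⟨L, R, A, ¯⟩ be a flat ABA framework and X a set of arguments in it. X is a stable extension of ⟨L, R, A, ¯⟩ if and only if X = {(AP, FP) ⊢ α an argument in ⟨L, R, A, ¯⟩ | AP ⊆ Λ_X}, where Λ_X = {β ∈ A | there is no argument (AP, FP) ⊢ ¯β in X}. -/
/-! ### Logic programs with negation-as-failure -/

/-- A classical literal over atoms `α`: `(true, a)` is the atom `a`,
`(false, a)` is the classically negated atom `¬ a`. -/
abbrev CLit (α : Type) := Bool × α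

/-- A general literal: a classical literal or a NAF literal `not l`. -/
inductive GLit (α : Type) where
  | cl (l : CLit α)
  | naf (l : CLit α)

/-- A clause `head ← pos₁,...,posₘ, not naf₁,..., not nafₙ`. -/
structure LPClause (α : Type) where
  head : CLit α
  pos : List (CLit α)
  naf : List (CLit α)

/-- A logic program: a set of clauses. -/
abbrev LogicProgram (α : Type) := Set (LPClause α)

/-- The Herbrand base of `P`: the atoms occurring in `P`. -/
def herbrand {α : Type} (P : LogicProgram α) : Set α :=
  {a | ∃ C ∈ P, C.head.2 = a ∨ (∃ l ∈ C.pos, l.2 = a) ∨ (∃ l ∈ C.naf, l.2 = a)}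

/-- `Lit_P` : all classical literals of `P`. -/
def litsOf {α : Type} (P : LogicProgram α) : Set (CLit α) := {l | l.2 ∈ herbrand P}

/-- `Δ_S = {not l ∈ NAF_P | l ∉ S}`, represented by the set of classical
literals `l` such that `not l ∈ Δ_S`. -/
def deltaOf {α : Type} (P : LogicProgram α) (S : Set (CLit α)) : Set (CLit α) :=
  {l | l ∈ litsOf P ∧ l ∉ S}

/-- `P ∪ Δ ⊢_MP k` : derivability by modus ponens on `←` from `P` together with
the NAF facts `{not l ← | not l ∈ Δ}`, treating NAF literals purely syntactically. -/
inductive DerivesMP {α : Type} (P : LogicProgram α) (Δ : Set (CLit α)) : GLit α → Prop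
  | nafFact {l : CLit α} : l ∈ Δ → DerivesMP P Δ (GLit.naf l)
  | mp {C : LPClause α} : C ∈ P → (∀ l ∈ C.pos, DerivesMP P Δ (GLit.cl l)) →
      (∀ l ∈ C.naf, DerivesMP P Δ (GLit.naf l)) → DerivesMP P Δ (GLit.cl C.head)

/-- The least set of classical literals closed under the clauses of a
(NAF-free) program. -/
def minClosed {α : Type} (P : LogicProgram α) : Set (CLit α) :=
  {l | DerivesMP P ∅ (GLit.cl l)}

/-- The answer set `AS(P)` of a NAF-free program `P`: the smallest `S ⊆ Lit_P`
closed under the clauses of `P`, which equals `Lit_P` in case it contains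
complementary classical literals `a` and `¬ a`. -/
def posAnswerSet {α : Type} (P : LogicProgram α) : Set (CLit α) :=
  minClosed P ∪
    {l | l ∈ litsOf P ∧ ∃ a : α, (true, a) ∈ minClosed P ∧ (false, a) ∈ minClosed P}

/-- The reduct `P^S`: delete every clause containing some `not l` with `l ∈ S`,
and delete all NAF literals from the remaining clauses. -/
def reduct {α : Type} (P : LogicProgram α) (S : Set (CLit α)) : LogicProgram α :=
  {C' | ∃ C ∈ P, (∀ l ∈ C.naf, l ∉ S) ∧ C' = LPClause.mk C.head C.pos []}

/-- `S` is an answer set of `P`: `S ⊆ Lit_P` and `S = AS(P^S)`. -/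
def IsAnswerSet {α : Type} (P : LogicProgram α) (S : Set (CLit α)) : Prop :=
  S ⊆ litsOf P ∧ S = posAnswerSet (reduct P S)

/-- `P` is consistent: it has an answer set different from `Lit_P`. -/
def LPConsistent {α : Type} (P : LogicProgram α) : Prop :=
  ∃ S, IsAnswerSet P S ∧ S ≠ litsOf P

/-- `S_NAF = S ∪ Δ_S`, as a set of general literals. -/
def withNaf {α : Type} (P : LogicProgram α) (S : Set (CLit α)) : Set (GLit α) :=
  (GLit.cl '' S) ∪ (GLit.naf '' deltaOf P S)

/-- `T` is an answer set with NAF literals of `P`. -/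
def IsAnswerSetNAF {α : Type} (P : LogicProgram α) (T : Set (GLit α)) : Prop :=
  ∃ S, IsAnswerSet P S ∧ T = withNaf P S

/-! ### ABA frameworks -/

/-- An inference rule `head ← body₁,...,bodyₘ`. -/
structure ABARule (L : Type) where
  head : L
  body : List L

/-- An ABA framework `⟨L, R, A, ¯⟩` (the language is the type `L`). -/
structure ABAFramework (L : Type) where
  rules : Set (ABARule L)
  assumptions : Set L
  contrary : L → L

/-- A flat ABA framework: no assumption is the head of a rule. -/
def ABAFlat {L : Type} (F : ABAFramework L) : Prop :=
  ∀ r ∈ F.rules, r.head ∉ F.assumptions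

/-- `s` is a fact of `F`, i.e. `s ← ∈ R`. -/
def IsFact {L : Type} (F : ABAFramework L) (s : L) : Prop :=
  ABARule.mk s [] ∈ F.rules

/-- Finite trees whose nodes hold sentences of `L`. -/
inductive ABATree (L : Type) where
  | leaf (s : L)
  | node (s : L) (children : List (ABATree L))

/-- The sentence held by the root of a tree (the conclusion). -/
def ABATree.concl {L : Type} : ABATree L → L
  | .leaf s => s
  | .node s _ => s

/-- `ABALeaf s u`: the sentence `s` is held by some leaf of the tree `u`. -/
inductive ABALeaf {L : Type} : L → ABATree L → Prop
  | leaf (s : L) : ABALeaf s (.leaf s)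
  | node {s x : L} {u : ABATree L} {cs : List (ABATree L)} :
      u ∈ cs → ABALeaf x u → ABALeaf x (.node s cs)

/-- Well-formed argument trees of `F`: every leaf holds an assumption or a fact,
and every non-leaf node holding `γ₀` has children `γ₁,...,γₘ` (`m > 0`) for some
rule `γ₀ ← γ₁,...,γₘ` of `F`. -/
inductive ABAWf {L : Type} (F : ABAFramework L) : ABATree L → Prop
  | leaf_asm {s : L} : s ∈ F.assumptions → ABAWf F (.leaf s)
  | leaf_fact {s : L} : IsFact F s → ABAWf F (.leaf s)
  | node {s : L} {cs : List (ABATree L)} : cs ≠ [] →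
      ABARule.mk s (cs.map ABATree.concl) ∈ F.rules →
      (∀ u ∈ cs, ABAWf F u) → ABAWf F (.node s cs)

/-- The assumption-premises of a tree: all assumptions held by leaves. -/
def APofTree {L : Type} (F : ABAFramework L) (u : ABATree L) : Set L :=
  {s | ABALeaf s u ∧ s ∈ F.assumptions}

/-- The fact-premises of a tree: all facts held by leaves. -/
def FPofTree {L : Type} (F : ABAFramework L) (u : ABATree L) : Set L :=
  {s | ABALeaf s u ∧ IsFact F s}

/-- An argument of `F`: a well-formed argument tree. -/
structure ABAArg {L : Type} (F : ABAFramework L) where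
  tree : ABATree L
  wf : ABAWf F tree

/-- The conclusion of an argument. -/
def ABAArg.concl {L : Type} {F : ABAFramework L} (A : ABAArg F) : L := A.tree.concl

/-- The assumption-premises `AP` of an argument. -/
def ABAArg.AP {L : Type} {F : ABAFramework L} (A : ABAArg F) : Set L :=
  APofTree F A.tree

/-- The fact-premises `FP` of an argument. -/
def ABAArg.FP {L : Type} {F : ABAFramework L} (A : ABAArg F) : Set L :=
  FPofTree F A.tree

/-- `(AP, FP) ⊢ a` is an argument in `F`. -/
def IsArgument {L : Type} (F : ABAFramework L) (AP FP : Set L) (a : L) : Prop :=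
  ∃ u : ABATree L, ABAWf F u ∧ u.concl = a ∧ APofTree F u = AP ∧ FPofTree F u = FP

/-- `A` attacks `B` (on some assumption-premise of `B`). -/
def Attacks {L : Type} {F : ABAFramework L} (A B : ABAArg F) : Prop :=
  ∃ b ∈ ABAArg.AP B, F.contrary b = ABAArg.concl A

/-- A set of arguments `X` attacks an argument `B`. -/
def SetAttacks {L : Type} {F : ABAFramework L} (X : Set (ABAArg F)) (B : ABAArg F) : Prop :=
  ∃ A ∈ X, Attacks A B

/-- `X` is a stable extension of `F`: `X` does not attack itself and attacks
every argument not belonging to `X`. -/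
def IsStableExt {L : Type} {F : ABAFramework L} (X : Set (ABAArg F)) : Prop :=
  (∀ B ∈ X, ¬ SetAttacks X B) ∧ ∀ B : ABAArg F, B ∉ X → SetAttacks X B

/-- `X` defends `A`: `X` attacks all attackers of `A`. -/
def Defends {L : Type} {F : ABAFramework L} (X : Set (ABAArg F)) (A : ABAArg F) : Prop :=
  ∀ B : ABAArg F, Attacks B A → SetAttacks X B

/-- `X` is an admissible extension of `F`. -/
def IsAdmissibleExt {L : Type} {F : ABAFramework L} (X : Set (ABAArg F)) : Prop :=
  (∀ B ∈ X, ¬ SetAttacks X B) ∧ ∀ A ∈ X, Defends X A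

/-- `R ∪ AP ⊢_MP a`: derivability by modus ponens from the rules `R`, treating
each member of `AP` as a fact. -/
inductive DerivesABA {L : Type} (R : Set (ABARule L)) (AP : Set L) : L → Prop
  | asm {s : L} : s ∈ AP → DerivesABA R AP s
  | mp {r : ABARule L} : r ∈ R → (∀ b ∈ r.body, DerivesABA R AP b) →
      DerivesABA R AP r.head

/-- The assumption-argument `({s}, ∅) ⊢ s` (resp. the fact-argument
`(∅, {s}) ⊢ s`), i.e. the one-node tree holding `s`, belongs to `X`. -/
def LeafArgMem {L : Type} {F : ABAFramework L} (X : Set (ABAArg F)) (s : L) : Prop :=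
  ∃ B ∈ X, B.tree = ABATree.leaf s

/-! ### The translated ABA framework of a logic program -/

/-- The translated ABA framework `ABA_P` of a logic program `P`:
rules are the clauses of `P` (with NAF literals as assumptions), assumptions
are `NAF_P`, and the contrary of `not l` is `l`. -/
def translateLP {α : Type} (P : LogicProgram α) : ABAFramework (GLit α) where
  rules := {r | ∃ C ∈ P,
    r = ABARule.mk (GLit.cl C.head) (C.pos.map GLit.cl ++ C.naf.map GLit.naf)}
  assumptions := {k | ∃ l ∈ litsOf P, k = GLit.naf l}
  contrary := fun k => match k with
    | GLit.cl l => GLit.cl l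
    | GLit.naf l => GLit.cl l

/-- `E` is the corresponding stable extension of the answer set `S`:
`E` is a stable extension of `ABA_P` and `S_NAF` is the set of conclusions of
arguments in `E`. -/
def CorrStableExt {α : Type} (P : LogicProgram α) (S : Set (CLit α))
    (E : Set (ABAArg (translateLP P))) : Prop :=
  IsStableExt E ∧ withNaf P S = {k | ∃ A ∈ E, ABAArg.concl A = k}

/-! ### Possibly infinite rooted labelled trees -/

/-- A (possibly infinite) rooted tree with nodes labelled by `β`: a type of
nodes with a parent function `par` fixing the root, such that every node
reaches the root by finitely many parent steps. -/
structure RTree (β : Type) where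
  N : Type
  root : N
  par : N → N
  label : N → β
  par_root : par root = root
  reaches : ∀ n : N, ∃ k : ℕ, par^[k] n = root

/-- The children of a node. -/
def RTree.children {β : Type} (t : RTree β) (n : t.N) : Set t.N :=
  {m | t.par m = n ∧ m ≠ t.root}

/-- A leaf node: a node without children. -/
def RTree.IsLeafNode {β : Type} (t : RTree β) (n : t.N) : Prop :=
  t.children n = ∅

theorem RTree.child_ne_root {β : Type} (t : RTree β) {m₀ : t.N}
    (h : t.children t.root = {m₀}) : m₀ ≠ t.root := by
  have hm : m₀ ∈ t.children t.root := by rw [h]; exact rfl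
  exact hm.2

theorem RTree.par_ne_root {β : Type} (t : RTree β) {m₀ : t.N}
    (h : t.children t.root = {m₀}) :
    ∀ n : t.N, n ≠ t.root → n ≠ m₀ → t.par n ≠ t.root := by
  intro n h1 h2 h3
  apply h2
  have hm : n ∈ t.children t.root := ⟨h3, h1⟩
  rwa [h, Set.mem_singleton_iff] at hm

open Classical in
/-- The parent function of the tree obtained by removing the root (whose unique
child is `m₀`). -/
noncomputable def RTree.delPar {β : Type} (t : RTree β) (m₀ : t.N)
    (hm₀ : m₀ ≠ t.root) (hp : ∀ n : t.N, n ≠ t.root → n ≠ m₀ → t.par n ≠ t.root) :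
    {n : t.N // n ≠ t.root} → {n : t.N // n ≠ t.root} := fun n =>
  if hn : n.1 = m₀ then ⟨m₀, hm₀⟩ else ⟨t.par n.1, hp n.1 n.2 hn⟩

/-- The subtree of `t` rooted at the unique child `m₀` of the root, obtained
from `t` by removing its root. -/
noncomputable def RTree.delRoot {β : Type} (t : RTree β) (m₀ : t.N)
    (h : t.children t.root = {m₀}) : RTree β where
  N := {n : t.N // n ≠ t.root}
  root := ⟨m₀, t.child_ne_root h⟩
  par := t.delPar m₀ (t.child_ne_root h) (t.par_ne_root h)
  label := fun n => t.label n.1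
  par_root := dif_pos rfl
  reaches := by
    have key : ∀ (k : ℕ) (n : t.N) (hn : n ≠ t.root), t.par^[k] n = t.root →
        ∃ j : ℕ, (t.delPar m₀ (t.child_ne_root h) (t.par_ne_root h))^[j] ⟨n, hn⟩ =
          ⟨m₀, t.child_ne_root h⟩ := by
      intro k
      induction k with
      | zero =>
        intro n hn h0
        simp only [Function.iterate_zero_apply] at h0
        exact absurd h0 hn
      | succ k ih =>
        intro n hn hk
        by_cases hm : n = m₀
        · refine ⟨0, ?_⟩
          simp only [Function.iterate_zero_apply]
          exact Subtype.ext hm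
        · have hpn : t.par n ≠ t.root := t.par_ne_root h n hn hm
          rw [Function.iterate_succ_apply] at hk
          obtain ⟨j, hj⟩ := ih (t.par n) hpn hk
          refine ⟨j + 1, ?_⟩
          rw [Function.iterate_succ_apply]
          have hstep : t.delPar m₀ (t.child_ne_root h) (t.par_ne_root h) ⟨n, hn⟩ =
              ⟨t.par n, hpn⟩ := dif_neg hm
          rw [hstep]
          exact hj
    rintro ⟨n, hn⟩
    obtain ⟨k, hk⟩ := t.reaches n
    exact key k n hn hk

/-! ### Attack Trees -/

/-- `t` is an Attack Tree of the argument `A` with respect to the set of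
arguments `X`.  Nodes hold arguments labelled `'+'` (`true`) or `'−'` (`false`). -/
structure IsAttackTree {L : Type} {F : ABAFramework L} (X : Set (ABAArg F))
    (A : ABAArg F) (t : RTree (ABAArg F × Bool)) : Prop where
  root_arg : (t.label t.root).1 = A
  root_lab : (t.label t.root).2 = true ↔ A ∈ X
  pos_complete : ∀ n : t.N, (t.label n).2 = true →
      ∀ B : ABAArg F, Attacks B (t.label n).1 →
        ∃ m ∈ t.children n, t.label m = (B, false)
  pos_sound : ∀ n : t.N, (t.label n).2 = true → ∀ m ∈ t.children n,
      (t.label m).2 = false ∧ Attacks (t.label m).1 (t.label n).1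
  neg_none : ∀ n : t.N, (t.label n).2 = false →
      (¬ ∃ B ∈ X, Attacks B (t.label n).1) → t.children n = ∅
  neg_one : ∀ n : t.N, (t.label n).2 = false →
      (∃ B ∈ X, Attacks B (t.label n).1) →
        ∃ m : t.N, t.children n = {m} ∧ (t.label m).2 = true ∧
          (t.label m).1 ∈ X ∧ Attacks (t.label m).1 (t.label n).1

/-- A positive Attack Tree: an Attack Tree whose root is labelled `'+'`. -/
def IsPosAttackTree {L : Type} {F : ABAFramework L} (X : Set (ABAArg F))
    (A : ABAArg F) (t : RTree (ABAArg F × Bool)) : Prop :=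
  IsAttackTree X A t ∧ (t.label t.root).2 = true

/-- A negative Attack Tree: an Attack Tree whose root is labelled `'−'`. -/
def IsNegAttackTree {L : Type} {F : ABAFramework L} (X : Set (ABAArg F))
    (A : ABAArg F) (t : RTree (ABAArg F × Bool)) : Prop :=
  IsAttackTree X A t ∧ (t.label t.root).2 = false

/-! ### Abstract dispute trees -/

/-- `t` is an abstract dispute tree for the argument `A`, where nodes labelled
`true` are proponent nodes and nodes labelled `false` are opponent nodes.
Under this encoding, the translated abstract dispute tree of an Attack Tree is
the Attack Tree itself (proponent = `'+'`, opponent = `'−'`). -/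
structure IsDisputeTree {L : Type} {F : ABAFramework L} (A : ABAArg F)
    (t : RTree (ABAArg F × Bool)) : Prop where
  root_lab : t.label t.root = (A, true)
  prop_complete : ∀ n : t.N, (t.label n).2 = true →
      ∀ B : ABAArg F, Attacks B (t.label n).1 →
        ∃ m ∈ t.children n, t.label m = (B, false)
  prop_sound : ∀ n : t.N, (t.label n).2 = true → ∀ m ∈ t.children n,
      (t.label m).2 = false ∧ Attacks (t.label m).1 (t.label n).1
  opp_one : ∀ n : t.N, (t.label n).2 = false →
      ∃ m : t.N, t.children n = {m} ∧ (t.label m).2 = true ∧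
        Attacks (t.label m).1 (t.label n).1

/-- An abstract dispute tree is admissible: no argument labels both a
proponent and an opponent node. -/
def AdmissibleDT {L : Type} {F : ABAFramework L} (t : RTree (ABAArg F × Bool)) : Prop :=
  ∀ n m : t.N, (t.label n).2 = true → (t.label m).2 = false →
    (t.label n).1 ≠ (t.label m).1
/-- `X` is a stable extension iff `X` consists of exactly the
arguments whose assumption-premises are contained in
`Λ_X = {β ∈ A | no argument in X has conclusion ¯β}`. -/
theorem stable_ext_iff_assumptions_unattacked {L : Type} (F : ABAFramework L)
    (hF : ABAFlat F) (X : Set (ABAArg F)) :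
    IsStableExt X ↔
      X = {A : ABAArg F | ABAArg.AP A ⊆
        {b | b ∈ F.assumptions ∧ ¬ ∃ B ∈ X, ABAArg.concl B = F.contrary b}} := by
  have key (B : ABAArg F) : ¬ SetAttacks X B ↔ ABAArg.AP B ⊆
      {b | b ∈ F.assumptions ∧ ¬ ∃ B ∈ X, ABAArg.concl B = F.contrary b} := by
    constructor
    · exact fun h b hb => ⟨hb.2, fun ⟨A, hA, e⟩ => h ⟨A, hA, b, hb, e.symm⟩⟩
    · exact fun h ⟨A, hA, b, hb, e⟩ => (h hb).2 ⟨A, hA, e.symm⟩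
  rw [Set.ext_iff]
  simp only [Set.mem_ofPred_eq, ← key]
  exact ⟨fun h B => ⟨h.1 B, fun hB => by_contra fun hn => hB (h.2 B hn)⟩,
    fun h => ⟨fun B => (h B).1, fun B hB => by_contra fun hn => hB ((h B).2 hn)⟩⟩
end

section
/- Let ⟨L, R, A, ¯⟩ be a flat ABA framework and X a stable extension of it. An argument (AP, FP) ⊢ α belongs to X if and only if for every β ∈ AP the assumption-argument ({β}, ∅) ⊢ β belongs to X and for every γ ∈ FP the fact-argument (∅, {γ}) ⊢ γ belongs to X. -/
/-- A set attacking a one-leaf argument attacks every argument having that leaf. -/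
theorem SetAttacks.of_leaf {L : Type} {F : ABAFramework L} {X : Set (ABAArg F)}
    {A B : ABAArg F} {s : L} (hB : B.tree = ABATree.leaf s) (hs : ABALeaf s A.tree)
    (h : SetAttacks X B) : SetAttacks X A := by
  obtain ⟨C, hC, b, ⟨hb, hbA⟩, hbC⟩ := h
  rw [hB] at hb
  cases hb
  exact ⟨C, hC, s, ⟨hs, hbA⟩, hbC⟩

/-- A stable extension contains the one-leaf arguments of the leaves of its members. -/
theorem IsStableExt.leafArgMem {L : Type} {F : ABAFramework L} {X : Set (ABAArg F)}
    (hX : IsStableExt X) {A : ABAArg F} (hA : A ∈ X) {s : L} (hs : ABALeaf s A.tree)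
    (hwf : ABAWf F (.leaf s)) : LeafArgMem X s := by
  refine ⟨⟨.leaf s, hwf⟩, ?_, rfl⟩
  by_contra hB
  exact hX.1 A hA (.of_leaf rfl hs (hX.2 _ hB))

/-- For a stable extension `X`, an argument `(AP, FP) ⊢ a` belongs
to `X` iff for every `β ∈ AP` the assumption-argument `({β},∅) ⊢ β` belongs to
`X` and for every `γ ∈ FP` the fact-argument `(∅,{γ}) ⊢ γ` belongs to `X`. -/
theorem mem_stable_ext_iff_premise_args_mem {L : Type} (F : ABAFramework L)
    (hF : ABAFlat F) (X : Set (ABAArg F)) (hX : IsStableExt X) (A : ABAArg F) :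
    A ∈ X ↔
      ((∀ b ∈ ABAArg.AP A, LeafArgMem X b) ∧ (∀ g ∈ ABAArg.FP A, LeafArgMem X g)) := by
  refine ⟨fun hA => ⟨fun b hb => hX.leafArgMem hA hb.1 (.leaf_asm hb.2),
    fun g hg => hX.leafArgMem hA hg.1 (.leaf_fact hg.2)⟩, fun h => ?_⟩
  by_contra hA
  obtain ⟨C, hC, b, hb, hbC⟩ := hX.2 A hA
  obtain ⟨B, hB, hBt⟩ := h.1 b hb
  refine hX.1 B hB ⟨C, hC, b, ⟨?_, hb.2⟩, hbC⟩
  rw [hBt]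
  exact .leaf b
end

section
/- Let ⟨L, R, A, ¯⟩ be a flat ABA framework and X a stable extension of it. An argument (AP, FP) ⊢ α does not belong to X if and only if there exists β ∈ AP such that the assumption-argument ({β}, ∅) ⊢ β does not belong to X. -/
/-- For a stable extension `X`, an argument `(AP, FP) ⊢ a` does not
belong to `X` iff there exists `β ∈ AP` whose assumption-argument
`({β},∅) ⊢ β` does not belong to `X`. -/
theorem not_mem_stable_ext_iff_premise_arg_not_mem {L : Type} (F : ABAFramework L)
    (hF : ABAFlat F) (X : Set (ABAArg F)) (hX : IsStableExt X) (A : ABAArg F) :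
    A ∉ X ↔ ∃ b ∈ ABAArg.AP A, ¬ LeafArgMem X b := by
  constructor
  · intro hA
    obtain ⟨C, hC, b, hb, hbC⟩ := hX.2 A hA
    refine ⟨b, hb, ?_⟩
    rintro ⟨B, hB, hBb⟩
    refine hX.1 B hB ⟨C, hC, b, ⟨?_, hb.2⟩, hbC⟩
    rw [hBb]
    exact ABALeaf.leaf b
  · rintro ⟨b, hb, hnot⟩ hA
    obtain ⟨C, hC, b', ⟨hleaf, -⟩, hbC⟩ :=
      hX.2 ⟨ABATree.leaf b, ABAWf.leaf_asm hb.2⟩ fun h => hnot ⟨_, h, rfl⟩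
    cases hleaf
    exact hX.1 A hA ⟨C, hC, b, hb, hbC⟩
end

section
/- Let P be a consistent logic program, S an answer set of P, and E the corresponding stable extension of S in the translated ABA framework ABA_P. If k ∈ S_NAF, then there exists an argument A ∈ E such that A : (AP, FP) ⊢ k with AP ⊆ Δ_S and FP ⊆ S. -/
/-- An answer set contains the head of every clause with empty body. -/
theorem head_mem_of_isAnswerSet {α : Type} {P : LogicProgram α} {S : Set (CLit α)}
    (hS : IsAnswerSet P S) {C : LPClause α} (hC : C ∈ P) (hpos : C.pos = [])
    (hnaf : C.naf = []) : C.head ∈ S := by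
  have hmem : LPClause.mk C.head C.pos [] ∈ reduct P S := ⟨C, hC, by simp [hnaf], rfl⟩
  rw [hS.2]
  exact Or.inl (DerivesMP.mp (C := ⟨C.head, C.pos, []⟩) hmem (by simp [hpos]) (by simp))

/-- If `k ∈ S_NAF`, then the corresponding stable extension `E`
contains an argument `(AP, FP) ⊢ k` with `AP ⊆ Δ_S` and `FP ⊆ S`. -/
theorem mem_answer_set_naf_corresponding_arg {α : Type} (P : LogicProgram α)
    (hP : LPConsistent P) (S : Set (CLit α)) (hS : IsAnswerSet P S)
    (E : Set (ABAArg (translateLP P))) (hE : CorrStableExt P S E)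
    (k : GLit α) (hk : k ∈ withNaf P S) :
    ∃ A ∈ E, ABAArg.concl A = k ∧ ABAArg.AP A ⊆ GLit.naf '' deltaOf P S ∧
      ABAArg.FP A ⊆ GLit.cl '' S := by
  obtain ⟨⟨hfree, -⟩, hconcl⟩ := hE
  obtain ⟨A, hAE, rfl⟩ := hconcl.subset hk
  refine ⟨A, hAE, rfl, ?_, ?_⟩
  · intro b hb
    obtain ⟨l, hl, rfl⟩ := hb.2
    refine ⟨l, ⟨hl, fun hlS => ?_⟩, rfl⟩
    obtain ⟨B, hBE, hB⟩ := hconcl.subset (Or.inl ⟨l, hlS, rfl⟩)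
    exact hfree A hAE ⟨B, hBE, GLit.naf l, hb, hB.symm⟩
  · rintro s ⟨-, C, hC, hrule⟩
    obtain ⟨rfl, hbody⟩ := ABARule.mk.inj hrule
    obtain ⟨hpos, hnaf⟩ := List.append_eq_nil_iff.mp hbody.symm
    exact ⟨C.head, head_mem_of_isAnswerSet hS hC (List.map_eq_nil_iff.mp hpos)
      (List.map_eq_nil_iff.mp hnaf), rfl⟩
end

section
/- Let P be a consistent logic program, E a stable extension of the translated ABA framework ABA_P, and Υ an Attack Tree of some argument A in ABA_P with respect to E. Then (1) for each node A_i^+ in Υ, A_i ∈ E, and (2) for each node A_i^− in Υ, A_i ∉ E. -/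
/-- Induction along the parent function of a rooted tree. -/
theorem RTree.induction {β : Type} (t : RTree β) {p : t.N → Prop} (root : p t.root)
    (child : ∀ n, p n → ∀ m ∈ t.children n, p m) (n : t.N) : p n := by
  obtain ⟨k, hk⟩ := t.reaches n
  induction k generalizing n with
  | zero => exact (show n = t.root from hk) ▸ root
  | succ k ih =>
    by_cases hn : n = t.root
    · exact hn ▸ root
    · exact child _ (ih (t.par n) hk) n ⟨rfl, hn⟩

/-- In an Attack Tree with respect to a conflict-free set of arguments, the positive nodes are
exactly those holding an argument of the set. -/
theorem IsAttackTree.label_eq_true_iff {L : Type} {F : ABAFramework L} {X : Set (ABAArg F)}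
    {A : ABAArg F} {t : RTree (ABAArg F × Bool)} (ht : IsAttackTree X A t)
    (hX : ∀ B ∈ X, ¬ SetAttacks X B) (n : t.N) :
    (t.label n).2 = true ↔ (t.label n).1 ∈ X := by
  refine t.induction (p := fun n => (t.label n).2 = true ↔ (t.label n).1 ∈ X) ?_ ?_ n
  · rw [ht.root_arg]
    exact ht.root_lab
  · intro n hn m hm
    cases hlab : (t.label n).2 with
    | true =>
      obtain ⟨hneg, hatt⟩ := ht.pos_sound n hlab m hm
      have hmX : (t.label m).1 ∉ X := fun h => hX _ (hn.mp hlab) ⟨_, h, hatt⟩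
      simp [hneg, hmX]
    | false =>
      by_cases hex : ∃ B ∈ X, Attacks B (t.label n).1
      · obtain ⟨m', hchildren, hpos, hmX, -⟩ := ht.neg_one n hlab hex
        rw [hchildren, Set.mem_singleton_iff] at hm
        subst hm
        exact iff_of_true hpos hmX
      · rw [ht.neg_none n hlab hex] at hm
        exact hm.elim

/-- In an Attack Tree with respect to a stable extension `E` of
`ABA_P`, every node labelled `'+'` holds an argument in `E` and every node
labelled `'−'` holds an argument not in `E`. -/
theorem attack_tree_labels {α : Type} (P : LogicProgram α) (hP : LPConsistent P)
    (E : Set (ABAArg (translateLP P))) (hE : IsStableExt E)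
    (A : ABAArg (translateLP P)) (t : RTree (ABAArg (translateLP P) × Bool))
    (ht : IsAttackTree E A t) :
    (∀ n : t.N, (t.label n).2 = true → (t.label n).1 ∈ E) ∧
    (∀ n : t.N, (t.label n).2 = false → (t.label n).1 ∉ E) := by
  have key := ht.label_eq_true_iff hE.1
  exact ⟨fun n hn => (key n).mp hn, fun n hn hmem => by simp [(key n).mpr hmem] at hn⟩
end

section
/- Let P be a consistent logic program, E a stable extension of the translated ABA framework ABA_P, and Υ an Attack Tree of some argument A in ABA_P with respect to E. Then (1) every node A_N^− in Υ has exactly one child node, and (2) all leaf nodes of Υ hold arguments labelled '+'. -/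
theorem RTree.mem_children_par {β : Type} (t : RTree β) {n : t.N} (hn : n ≠ t.root) :
    n ∈ t.children (t.par n) :=
  ⟨rfl, hn⟩

namespace IsAttackTree

variable {L : Type} {F : ABAFramework L} {X : Set (ABAArg F)} {A : ABAArg F}
  {t : RTree (ABAArg F × Bool)}

/-- Every child of a node labelled `'−'` is labelled `'+'` and holds an argument in `X`. -/
theorem child_of_neg (ht : IsAttackTree X A t) {n m : t.N} (hn : (t.label n).2 = false)
    (hm : m ∈ t.children n) : (t.label m).2 = true ∧ (t.label m).1 ∈ X := by
  by_cases h : ∃ B ∈ X, Attacks B (t.label n).1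
  · obtain ⟨k, hk, hpos, hX, -⟩ := ht.neg_one n hn h
    rw [hk, Set.mem_singleton_iff] at hm
    exact hm ▸ ⟨hpos, hX⟩
  · simp [ht.neg_none n hn h] at hm

theorem pos_mem (ht : IsAttackTree X A t) {n : t.N} (hn : (t.label n).2 = true) :
    (t.label n).1 ∈ X := by
  by_cases hr : n = t.root
  · subst hr
    rw [ht.root_arg]
    exact ht.root_lab.mp hn
  · have hc := t.mem_children_par hr
    cases hp : (t.label (t.par n)).2 with
    | false => exact (ht.child_of_neg hp hc).2
    | true => simp [(ht.pos_sound _ hp n hc).1] at hn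

/-- In an Attack Tree with respect to a conflict-free set `X`, nodes labelled `'−'` hold
arguments outside `X`. -/
theorem neg_notMem (ht : IsAttackTree X A t) (hX : ∀ B ∈ X, ¬ SetAttacks X B) {n : t.N}
    (hn : (t.label n).2 = false) : (t.label n).1 ∉ X := by
  by_cases hr : n = t.root
  · subst hr
    rw [ht.root_arg, ← ht.root_lab, hn]
    exact Bool.false_ne_true
  · have hc := t.mem_children_par hr
    cases hp : (t.label (t.par n)).2 with
    | false => simp [(ht.child_of_neg hp hc).1] at hn
    | true =>
      exact fun hmem => hX _ (ht.pos_mem hp) ⟨_, hmem, (ht.pos_sound _ hp n hc).2⟩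

theorem exists_children_eq_singleton (ht : IsAttackTree X A t) (hX : IsStableExt X) {n : t.N}
    (hn : (t.label n).2 = false) : ∃ m : t.N, t.children n = {m} := by
  obtain ⟨m, hm, -⟩ := ht.neg_one n hn (hX.2 _ (ht.neg_notMem hX.1 hn))
  exact ⟨m, hm⟩

end IsAttackTree

/-- In an Attack Tree with respect to a stable extension `E` of
`ABA_P`, every node labelled `'−'` has exactly one child node, and all leaf
nodes hold arguments labelled `'+'`. -/
theorem attack_tree_neg_one_child_and_leaves_pos {α : Type} (P : LogicProgram α)
    (hP : LPConsistent P)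
    (E : Set (ABAArg (translateLP P))) (hE : IsStableExt E)
    (A : ABAArg (translateLP P)) (t : RTree (ABAArg (translateLP P) × Bool))
    (ht : IsAttackTree E A t) :
    (∀ n : t.N, (t.label n).2 = false → ∃ m : t.N, t.children n = {m}) ∧
    (∀ n : t.N, t.IsLeafNode n → (t.label n).2 = true) := by
  have h : ∀ n : t.N, (t.label n).2 = false → ∃ m : t.N, t.children n = {m} :=
    fun n hn => ht.exists_children_eq_singleton hE hn
  refine ⟨h, fun n hleaf => ?_⟩
  by_contra hn
  obtain ⟨m, hm⟩ := h n (Bool.eq_false_of_not_eq_true hn)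
  exact Set.singleton_ne_empty m (hm.symm.trans hleaf)
end

section
/- Let P be a consistent logic program, E a stable extension of the translated ABA framework ABA_P, and attTree_E^+(A) a positive Attack Tree of some argument A in ABA_P with respect to E. Then the set Args of all arguments labelled '+' in attTree_E^+(A) is an admissible extension of ABA_P, and Args ⊆ E. -/
theorem IsAttackTree.mem_of_label_true {L : Type} {F : ABAFramework L} {X : Set (ABAArg F)}
    {A : ABAArg F} {t : RTree (ABAArg F × Bool)} (ht : IsAttackTree X A t) {n : t.N}
    (hn : (t.label n).2 = true) : (t.label n).1 ∈ X := by
  by_cases hr : n = t.root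
  · subst hr
    rw [ht.root_arg]
    exact ht.root_lab.mp hn
  have hc : n ∈ t.children (t.par n) := ⟨rfl, hr⟩
  cases hp : (t.label (t.par n)).2 with
  | true =>
    have hf := (ht.pos_sound _ hp n hc).1
    rw [hn] at hf
    cases hf
  | false =>
    by_cases ha : ∃ B ∈ X, Attacks B (t.label (t.par n)).1
    · obtain ⟨m, hm, -, hX, -⟩ := ht.neg_one _ hp ha
      rw [hm, Set.mem_singleton_iff] at hc
      rwa [hc]
    · rw [ht.neg_none _ hp ha] at hc
      exact hc.elim

theorem IsAttackTree.plus_subset {L : Type} {F : ABAFramework L} {X : Set (ABAArg F)}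
    {A : ABAArg F} {t : RTree (ABAArg F × Bool)} (ht : IsAttackTree X A t) :
    {B : ABAArg F | ∃ n : t.N, t.label n = (B, true)} ⊆ X := by
  rintro B ⟨n, hn⟩
  simpa [hn] using ht.mem_of_label_true (n := n) (by simp [hn])

theorem IsAttackTree.plus_admissible {L : Type} {F : ABAFramework L} {X : Set (ABAArg F)}
    {A : ABAArg F} {t : RTree (ABAArg F × Bool)} (ht : IsAttackTree X A t)
    (hX : IsStableExt X) :
    IsAdmissibleExt {B : ABAArg F | ∃ n : t.N, t.label n = (B, true)} := by
  refine ⟨fun B hB ⟨C, hC, hCB⟩ =>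
    hX.1 B (ht.plus_subset hB) ⟨C, ht.plus_subset hC, hCB⟩, ?_⟩
  intro B hB C hCB
  have hC : C ∉ X := fun hC => hX.1 B (ht.plus_subset hB) ⟨C, hC, hCB⟩
  obtain ⟨n, hn⟩ := hB
  obtain ⟨m, -, hm⟩ := ht.pos_complete n (by rw [hn]) C (by rwa [hn])
  obtain ⟨k, -, hk, -, hatt⟩ := ht.neg_one m (by rw [hm]) (by rw [hm]; exact hX.2 C hC)
  exact ⟨(t.label k).1, ⟨k, Prod.ext rfl hk⟩, by rwa [hm] at hatt⟩

/-- The set of all arguments labelled `'+'` in a positive Attack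
Tree w.r.t. a stable extension `E` of `ABA_P` is an admissible extension of
`ABA_P` and a subset of `E`. -/
theorem pos_attack_tree_plus_args_admissible {α : Type} (P : LogicProgram α)
    (hP : LPConsistent P)
    (E : Set (ABAArg (translateLP P))) (hE : IsStableExt E)
    (A : ABAArg (translateLP P)) (t : RTree (ABAArg (translateLP P) × Bool))
    (ht : IsPosAttackTree E A t) :
    IsAdmissibleExt {B : ABAArg (translateLP P) | ∃ n : t.N, t.label n = (B, true)} ∧
      {B : ABAArg (translateLP P) | ∃ n : t.N, t.label n = (B, true)} ⊆ E := by
  exact ⟨ht.1.plus_admissible hE, ht.1.plus_subset⟩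
end

section
/- Let P be a consistent logic program, S an answer set of P, k ∈ S_NAF, and E the corresponding stable extension of S in ABA_P. Let A ∈ E be a corresponding argument of k and attTree_E^+(A) a positive Attack Tree of A with respect to E. Then the set of conclusions of all arguments labelled '+' in attTree_E^+(A), i.e. {k1 | A1^+ : (AP, FP) ⊢ k1 occurs in attTree_E^+(A)}, is a subset of S_NAF. -/
/-- For `k ∈ S_NAF`, a corresponding argument `A ∈ E` of `k` and
a positive Attack Tree of `A` w.r.t. the corresponding stable extension `E`,
the set of conclusions of all arguments labelled `'+'` in the Attack Tree is a
subset of `S_NAF`. -/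
theorem pos_attack_tree_plus_concls_subset {α : Type} (P : LogicProgram α)
    (hP : LPConsistent P) (S : Set (CLit α)) (hS : IsAnswerSet P S)
    (E : Set (ABAArg (translateLP P))) (hE : CorrStableExt P S E)
    (k : GLit α) (hk : k ∈ withNaf P S)
    (A : ABAArg (translateLP P)) (hAE : A ∈ E) (hAk : ABAArg.concl A = k)
    (t : RTree (ABAArg (translateLP P) × Bool)) (ht : IsPosAttackTree E A t) :
    {k1 : GLit α | ∃ n : t.N, (t.label n).2 = true ∧
      ABAArg.concl (t.label n).1 = k1} ⊆ withNaf P S := by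
  rintro _ ⟨n, hn, rfl⟩
  rw [hE.2]
  exact ⟨_, ht.1.mem_of_label_true hn, rfl⟩
end
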